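/- arXiv:1806.09327 — 4 statements merged into one kernel-verified Lean document; each statement's English description precedes it below -/
import Mathlib

section
/- Let k be a field, H and G groupoids, and φ : H ⥤ G a faithful functor whose object map is injective. Then φ is a Frobenius morphism — i.e., the left and right Kan extension functors φ.lan, φ.ran : (H ⥤ ModuleCat k) ⥤ (G ⥤ ModuleCat k) are naturally isomorphic — if and only if for every object x of G, the category StructuredArrow x φ has only finitely many connected components, i.e., Finite (ConnectedComponents (StructuredArrow x φ)). -/
open CategoryTheory

set_option maxHeartbeats 1000000
set_option synthInstance.maxHeartbeats 200000

section Components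

variable {H G : Type*} [Groupoid H] [Groupoid G] (φ : H ⥤ G)

theorem structuredArrow_components_eq_iff {x : G} (a b : StructuredArrow x φ) :
    CategoryTheory.ConnectedComponents.mk a = CategoryTheory.ConnectedComponents.mk b ↔
      ∃ h : a.right ⟶ b.right, a.hom ≫ φ.map h = b.hom := by
  constructor
  · intro e
    have z : Zigzag a b := Quotient.exact' e
    induction z with
    | refl => exact ⟨𝟙 _, by simp⟩
    | tail _ z ih =>
      rename_i p q _
      obtain ⟨h, hh⟩ := ih (Quotient.sound' ‹_›)
      rcases z with ⟨⟨f⟩⟩ | ⟨⟨f⟩⟩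
      · exact ⟨h ≫ f.right, by
          rw [φ.map_comp, ← Category.assoc, hh, StructuredArrow.w]⟩
      · refine ⟨h ≫ inv f.right, ?_⟩
        rw [φ.map_comp, ← Category.assoc, hh, ← StructuredArrow.w f, Category.assoc,
          ← φ.map_comp, IsIso.hom_inv_id, φ.map_id, Category.comp_id]
  · rintro ⟨h, hh⟩
    exact Quotient.sound (Zigzag.of_hom (StructuredArrow.homMk h hh))

end Components

section ExtendByZero

variable {H G C : Type*} [Groupoid H] [Groupoid G] [Category C] [Preadditive C]
  (φ : H ⥤ G) (F : H ⥤ C)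

open Classical in
/-- The action of `b : φ u ⟶ φ v` on `F` when `b` lifts along `φ`, and zero otherwise. -/
noncomputable def extendByZero {u v : H} (b : φ.obj u ⟶ φ.obj v) : F.obj u ⟶ F.obj v :=
  if h : ∃ f : u ⟶ v, φ.map f = b then F.map h.choose else 0

theorem extendByZero_map [φ.Faithful] {u v : H} (f : u ⟶ v) :
    extendByZero φ F (φ.map f) = F.map f := by
  have h : ∃ g : u ⟶ v, φ.map g = φ.map f := ⟨f, rfl⟩
  rw [extendByZero, dif_pos h, φ.map_injective h.choose_spec]

theorem extendByZero_of_not_exists {u v : H} {b : φ.obj u ⟶ φ.obj v}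
    (h : ¬ ∃ f : u ⟶ v, φ.map f = b) : extendByZero φ F b = 0 :=
  dif_neg h

theorem map_comp_extendByZero [φ.Faithful] {u v w : H} (f : u ⟶ v)
    (b : φ.obj v ⟶ φ.obj w) :
    F.map f ≫ extendByZero φ F b = extendByZero φ F (φ.map f ≫ b) := by
  by_cases h : ∃ g : v ⟶ w, φ.map g = b
  · obtain ⟨g, rfl⟩ := h
    rw [← φ.map_comp, extendByZero_map, extendByZero_map, F.map_comp]
  · rw [extendByZero_of_not_exists φ F h, Limits.comp_zero, extendByZero_of_not_exists]
    rintro ⟨g, hg⟩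
    exact h ⟨inv f ≫ g, by simp [hg]⟩

theorem extendByZero_comp_map [φ.Faithful] {u v w : H} (b : φ.obj u ⟶ φ.obj v)
    (f : v ⟶ w) :
    extendByZero φ F b ≫ F.map f = extendByZero φ F (b ≫ φ.map f) := by
  by_cases h : ∃ g : u ⟶ v, φ.map g = b
  · obtain ⟨g, rfl⟩ := h
    rw [← φ.map_comp, extendByZero_map, extendByZero_map, F.map_comp]
  · rw [extendByZero_of_not_exists φ F h, Limits.zero_comp, extendByZero_of_not_exists]
    rintro ⟨g, hg⟩
    exact h ⟨g ≫ inv f, by simp [hg]⟩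

theorem extendByZero_naturality [φ.Faithful] {F F' : H ⥤ C} (τ : F ⟶ F') {u v : H}
    (b : φ.obj u ⟶ φ.obj v) :
    extendByZero φ F b ≫ τ.app v = τ.app u ≫ extendByZero φ F' b := by
  by_cases h : ∃ g : u ⟶ v, φ.map g = b
  · obtain ⟨g, rfl⟩ := h
    rw [extendByZero_map, extendByZero_map, τ.naturality]
  · rw [extendByZero_of_not_exists φ F h, extendByZero_of_not_exists φ F' h,
      Limits.zero_comp, Limits.comp_zero]

end ExtendByZero

section KanExtension

variable {H G C : Type*} [Groupoid H] [Groupoid G] [Category C] [Preadditive C]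
  {φ : H ⥤ G} [φ.Faithful] {F : H ⥤ C} {R : G ⥤ C} {c : φ ⋙ R ⟶ F}
  (hc : (Functor.RightExtension.mk R c).IsPointwiseRightKanExtension)

/-- The cone over `StructuredArrow (φ u) φ` with apex `F u` given by extension by zero. -/
noncomputable def extendByZeroCone (φ : H ⥤ G) [φ.Faithful] (F : H ⥤ C) (u : H) :
    Limits.Cone (StructuredArrow.proj (φ.obj u) φ ⋙ F) where
  pt := F.obj u
  π :=
    { app := fun a => extendByZero φ F a.hom
      naturality := fun a b f => by
        have h := extendByZero_comp_map φ F a.hom f.right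
        rw [StructuredArrow.w] at h
        exact (Category.id_comp _).trans h.symm }

/-- The map from `F` to the restriction of its right Kan extension which is extension by zero in
each coordinate. -/
noncomputable def toRightKanExtensionApp (u : H) : F.obj u ⟶ R.obj (φ.obj u) :=
  (hc (φ.obj u)).lift (extendByZeroCone φ F u)

omit [Preadditive C] [φ.Faithful] in
include hc in
theorem rightKanExtension_hom_ext {x : G} {T : C} {f g : T ⟶ R.obj x}
    (h : ∀ (v : H) (a : x ⟶ φ.obj v), f ≫ R.map a ≫ c.app v = g ≫ R.map a ≫ c.app v) :
    f = g :=
  (hc x).hom_ext fun a => h a.right a.hom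

theorem toRightKanExtensionApp_comp {u v : H} (a : φ.obj u ⟶ φ.obj v) :
    toRightKanExtensionApp hc u ≫ R.map a ≫ c.app v = extendByZero φ F a :=
  (hc (φ.obj u)).fac (extendByZeroCone φ F u) (StructuredArrow.mk a)

/-- Extension by zero as a natural transformation. -/
noncomputable def toRightKanExtension : F ⟶ φ ⋙ R where
  app u := toRightKanExtensionApp hc u
  naturality u v f := rightKanExtension_hom_ext hc fun w a => by
    rw [Category.assoc, Category.assoc, toRightKanExtensionApp_comp, map_comp_extendByZero,
      ← toRightKanExtensionApp_comp hc, Functor.comp_map, R.map_comp, Category.assoc]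

theorem toRightKanExtension_comp {u v : H} (a : φ.obj u ⟶ φ.obj v) :
    (toRightKanExtension hc).app u ≫ R.map a ≫ c.app v = extendByZero φ F a :=
  toRightKanExtensionApp_comp hc a

theorem toRightKanExtension_naturality {F' : H ⥤ C} {R' : G ⥤ C} {c' : φ ⋙ R' ⟶ F'}
    (hc' : (Functor.RightExtension.mk R' c').IsPointwiseRightKanExtension)
    (τ : F ⟶ F') (ρ : R ⟶ R') (h : Functor.whiskerLeft φ ρ ≫ c' = c ≫ τ) :
    toRightKanExtension hc ≫ Functor.whiskerLeft φ ρ = τ ≫ toRightKanExtension hc' := by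
  ext u
  refine rightKanExtension_hom_ext hc' fun v a => ?_
  have hv : ρ.app (φ.obj v) ≫ c'.app v = c.app v ≫ τ.app v := congr_app h v
  rw [NatTrans.comp_app, NatTrans.comp_app, Category.assoc, Category.assoc,
    toRightKanExtension_comp, Functor.whiskerLeft_app, ← ρ.naturality_assoc, hv,
    ← extendByZero_naturality, ← toRightKanExtension_comp hc]
  simp only [Category.assoc]

/-- The costructured arrow inverse to a structured arrow. -/
def costructuredArrowInv {x : G} (a : StructuredArrow x φ) : CostructuredArrow φ x :=
  CostructuredArrow.mk (Y := a.right) (Groupoid.inv a.hom)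

/-- The leg of a cocone at the inverse of a structured arrow. -/
def inverseLeg {x : G} (s : Limits.Cocone (CostructuredArrow.proj φ x ⋙ F))
    (a : StructuredArrow x φ) : F.obj a.right ⟶ s.pt :=
  s.ι.app (costructuredArrowInv a)

theorem extendByZero_comp_cocone {x : G} (s : Limits.Cocone (CostructuredArrow.proj φ x ⋙ F))
    (b : CostructuredArrow φ x) (a : StructuredArrow x φ) (f : b.left ⟶ a.right)
    (hf : φ.map f = b.hom ≫ a.hom) :
    extendByZero φ F (b.hom ≫ a.hom) ≫ inverseLeg s a = s.ι.app b := by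
  rw [← hf, extendByZero_map]
  exact s.w (CostructuredArrow.homMk (f := b) (f' := costructuredArrowInv a) f (by
    simp [costructuredArrowInv, hf]))

omit [φ.Faithful] in
theorem extendByZero_eq_zero_of_components_ne {x : G} (a b : StructuredArrow x φ)
    (h : CategoryTheory.ConnectedComponents.mk a ≠ CategoryTheory.ConnectedComponents.mk b) :
    extendByZero φ F (Groupoid.inv a.hom ≫ b.hom) = 0 := by
  refine extendByZero_of_not_exists φ F ?_
  rintro ⟨f, hf⟩
  exact h ((structuredArrow_components_eq_iff φ a b).2 ⟨f, by simp [hf]⟩)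

/-- A structured arrow representing a given component. -/
noncomputable def componentRep {x : G} (o : ConnectedComponents (StructuredArrow x φ)) :
    StructuredArrow x φ :=
  Quotient.out o

omit [φ.Faithful] in
theorem mk_componentRep {x : G} (o : ConnectedComponents (StructuredArrow x φ)) :
    CategoryTheory.ConnectedComponents.mk (componentRep o) = o :=
  Quotient.out_eq' o

theorem sum_componentRep_eq_id {x : G} [Fintype (ConnectedComponents (StructuredArrow x φ))] :
    ∑ o : ConnectedComponents (StructuredArrow x φ),
      R.map (componentRep o).hom ≫ c.app (componentRep o).right ≫
        (toRightKanExtension hc).app (componentRep o).right ≫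
          R.map (Groupoid.inv (componentRep o).hom) = 𝟙 (R.obj x) := by
  refine rightKanExtension_hom_ext hc fun v b => ?_
  have key (a : StructuredArrow x φ) :
      (R.map a.hom ≫ c.app a.right ≫
        (toRightKanExtension hc).app a.right ≫ R.map (Groupoid.inv a.hom)) ≫ R.map b ≫ c.app v =
      R.map a.hom ≫ c.app a.right ≫ extendByZero φ F (Groupoid.inv a.hom ≫ b) := by
    rw [← toRightKanExtension_comp hc, R.map_comp]
    simp only [Category.assoc]
  rw [Category.id_comp, Preadditive.sum_comp,
    Finset.sum_eq_single (CategoryTheory.ConnectedComponents.mk (StructuredArrow.mk b)), key]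
  · obtain ⟨f, hf⟩ := (structuredArrow_components_eq_iff φ _ (StructuredArrow.mk b)).1
      (mk_componentRep _)
    generalize componentRep (CategoryTheory.ConnectedComponents.mk (StructuredArrow.mk b)) = a
      at f hf ⊢
    change a.right ⟶ v at f
    change a.hom ≫ φ.map f = b at hf
    have hn : R.map (φ.map f) ≫ c.app v = c.app _ ≫ F.map f := c.naturality f
    have hf' : Groupoid.inv a.hom ≫ b = φ.map f := by simp [← hf]
    rw [hf', extendByZero_map, ← hn, ← R.map_comp_assoc, hf]
  · intro o _ ho
    have h0 : extendByZero φ F (Groupoid.inv (componentRep o).hom ≫ b) = 0 :=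
      extendByZero_eq_zero_of_components_ne (componentRep o) (StructuredArrow.mk b)
        (by rwa [mk_componentRep])
    rw [key, h0]
    simp
  · simp

/-- The map out of the right Kan extension induced by a cocone, when there are finitely many
components. -/
noncomputable def rightKanExtensionDesc (c : φ ⋙ R ⟶ F) {x : G}
    [Fintype (ConnectedComponents (StructuredArrow x φ))]
    (s : Limits.Cocone (CostructuredArrow.proj φ x ⋙ F)) : R.obj x ⟶ s.pt :=
  ∑ o, R.map (componentRep o).hom ≫ c.app (componentRep o).right ≫
    inverseLeg s (componentRep o)

theorem toRightKanExtension_comp_desc {x : G}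
    [Fintype (ConnectedComponents (StructuredArrow x φ))]
    (s : Limits.Cocone (CostructuredArrow.proj φ x ⋙ F)) (b : CostructuredArrow φ x) :
    ((toRightKanExtension hc).app b.left ≫ R.map b.hom) ≫ rightKanExtensionDesc c s =
      s.ι.app b := by
  let a : StructuredArrow x φ := StructuredArrow.mk (Groupoid.inv b.hom)
  have hb : Groupoid.inv a.hom = b.hom := by simp [a]
  have key (d : StructuredArrow x φ) :
      ((toRightKanExtension hc).app b.left ≫ R.map b.hom) ≫
        R.map d.hom ≫ c.app d.right ≫ inverseLeg s d =
      extendByZero φ F (b.hom ≫ d.hom) ≫ inverseLeg s d := by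
    have h := toRightKanExtension_comp hc (b.hom ≫ d.hom)
    rw [R.map_comp] at h
    simp only [Category.assoc] at h ⊢
    rw [← h]
    simp only [Category.assoc]
  rw [rightKanExtensionDesc, Preadditive.comp_sum,
    Finset.sum_eq_single (CategoryTheory.ConnectedComponents.mk a), key]
  · obtain ⟨f, hf⟩ := (structuredArrow_components_eq_iff φ a _).1 (mk_componentRep _).symm
    exact extendByZero_comp_cocone s b _ f (by simp [← hf, a])
  · intro o _ ho
    rw [key, ← hb]
    refine Eq.trans (congrArg (· ≫ _)
      (extendByZero_eq_zero_of_components_ne a (componentRep o) ?_)) Limits.zero_comp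
    rw [mk_componentRep]
    exact ho.symm
  · simp

theorem eq_rightKanExtensionDesc {x : G}
    [Fintype (ConnectedComponents (StructuredArrow x φ))]
    (s : Limits.Cocone (CostructuredArrow.proj φ x ⋙ F)) (m : R.obj x ⟶ s.pt)
    (hm : ∀ b : CostructuredArrow φ x,
      ((toRightKanExtension hc).app b.left ≫ R.map b.hom) ≫ m = s.ι.app b) :
    m = rightKanExtensionDesc c s := by
  rw [← Category.id_comp m, ← sum_componentRep_eq_id hc, Preadditive.sum_comp]
  refine Finset.sum_congr rfl fun o _ => ?_
  rw [inverseLeg, ← hm (costructuredArrowInv (componentRep o))]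
  simp [costructuredArrowInv]

/-- If each `StructuredArrow x φ` has finitely many components, then extension by zero exhibits
the right Kan extension as a left Kan extension. -/
noncomputable def isPointwiseLeftKanExtensionToRightKanExtension
    (hfin : ∀ x : G, Finite (ConnectedComponents (StructuredArrow x φ))) :
    (Functor.LeftExtension.mk R (toRightKanExtension hc)).IsPointwiseLeftKanExtension :=
  fun x =>
  letI := Fintype.ofFinite (ConnectedComponents (StructuredArrow x φ))
  { desc := fun s => rightKanExtensionDesc c s
    fac := toRightKanExtension_comp_desc hc
    uniq := eq_rightKanExtensionDesc hc }

variable (C) (φ) in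
/-- The comparison isomorphism between left and right Kan extensions. -/
noncomputable def lanIsoRan [∀ F : H ⥤ C, φ.HasLeftKanExtension F]
    [∀ F : H ⥤ C, φ.HasPointwiseRightKanExtension F]
    (hfin : ∀ x : G, Finite (ConnectedComponents (StructuredArrow x φ))) :
    (φ.lan : (H ⥤ C) ⥤ (G ⥤ C)) ≅ φ.ran :=
  let N (F : H ⥤ C) : F ⟶ φ ⋙ φ.ran.obj F :=
    toRightKanExtension (φ.isPointwiseRightKanExtensionRanCounit F)
  haveI (F : H ⥤ C) : (φ.ran.obj F).IsLeftKanExtension (N F) :=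
    (isPointwiseLeftKanExtensionToRightKanExtension
      (φ.isPointwiseRightKanExtensionRanCounit F) hfin).isLeftKanExtension
  NatIso.ofComponents
    (fun F => Functor.leftKanExtensionUnique (φ.lan.obj F) (φ.lanUnit.app F) (φ.ran.obj F) (N F))
    fun {F F'} τ => by
      have hN : N F ≫ Functor.whiskerLeft φ (φ.ran.map τ) = τ ≫ N F' :=
        toRightKanExtension_naturality _ _ τ (φ.ran.map τ) (φ.ranCounit.naturality τ)
      have hL : φ.lanUnit.app F ≫ Functor.whiskerLeft φ (φ.lan.map τ) = τ ≫ φ.lanUnit.app F' :=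
        (φ.lanUnit.naturality τ).symm
      refine (φ.lan.obj F).hom_ext_of_isLeftKanExtension (φ.lanUnit.app F) _ _ ?_
      simp only [Functor.leftKanExtensionUnique_hom, Functor.whiskerLeft_comp]
      rw [reassoc_of% hL, Functor.descOfIsLeftKanExtension_fac,
        Functor.descOfIsLeftKanExtension_fac_assoc, hN]

end KanExtension

section Dimension

variable {k : Type} [Field k] {H G : Type} [Groupoid H] [Groupoid.{0} G] {φ : H ⥤ G}

/-- A family of linear forms on `V`, indexed by structured arrows and constant along morphisms,
as a cone over the constant diagram `k`. -/
def coneOfForms {x : G} (V : ModuleCat.{0} k) (p : StructuredArrow x φ → V →ₗ[k] k)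
    (hp : ∀ {a b : StructuredArrow x φ}, (a ⟶ b) → p a = p b) :
    Limits.Cone (StructuredArrow.proj x φ ⋙ (Functor.const H).obj (ModuleCat.of k k)) where
  pt := V
  π :=
    { app := fun a => ModuleCat.ofHom (p a)
      naturality := fun a b f => by
        change 𝟙 V ≫ ModuleCat.ofHom (p b) = ModuleCat.ofHom (p a) ≫ 𝟙 (ModuleCat.of k k)
        rw [Category.id_comp, Category.comp_id, hp f] }

theorem exists_injective_of_forms {R : G ⥤ ModuleCat.{0} k}
    {c : φ ⋙ R ⟶ (Functor.const H).obj (ModuleCat.of k k)}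
    (hc : (Functor.RightExtension.mk R c).IsPointwiseRightKanExtension)
    {x : G} (V : ModuleCat.{0} k) (p : StructuredArrow x φ → V →ₗ[k] k)
    (hp : ∀ {a b : StructuredArrow x φ}, (a ⟶ b) → p a = p b)
    (hinj : ∀ v w : V, (∀ a, p a v = p a w) → v = w) :
    ∃ f : V →ₗ[k] R.obj x, Function.Injective f := by
  let f : V ⟶ R.obj x := (hc x).lift (coneOfForms V p hp)
  have hf (a : StructuredArrow x φ) : f ≫ R.map a.hom ≫ c.app a.right = ModuleCat.ofHom (p a) :=
    (hc x).fac (coneOfForms V p hp) a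
  refine ⟨f.hom, fun v w h => hinj v w fun a => ?_⟩
  have hv (u : V) : p a u = (R.map a.hom ≫ c.app a.right).hom (f.hom u) :=
    (congrArg (fun t => t.hom u) (hf a)).symm
  rw [hv, hv, h]

theorem exists_injective_dual {L R : G ⥤ ModuleCat.{0} k}
    {e : (Functor.const H).obj (ModuleCat.of k k) ⟶ φ ⋙ L}
    {c : φ ⋙ R ⟶ (Functor.const H).obj (ModuleCat.of k k)}
    (he : (Functor.LeftExtension.mk L e).IsPointwiseLeftKanExtension)
    (hc : (Functor.RightExtension.mk R c).IsPointwiseRightKanExtension) (x : G) :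
    ∃ f : Module.Dual k (L.obj x) →ₗ[k] R.obj x, Function.Injective f := by
  let j (a : StructuredArrow x φ) : ModuleCat.of k k ⟶ L.obj x :=
    e.app a.right ≫ L.map (Groupoid.inv a.hom)
  have hj {a b : StructuredArrow x φ} (f : a ⟶ b) : j a = j b := by
    have h1 : L.map (Groupoid.inv a.hom) =
        L.map (φ.map f.right) ≫ L.map (Groupoid.inv b.hom) := by
      rw [← L.map_comp, ← StructuredArrow.w f]
      congr 1
      simp
    have h2 : e.app a.right ≫ L.map (φ.map f.right) = e.app b.right :=
      (e.naturality f.right).symm.trans (Category.id_comp _)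
    change e.app a.right ≫ _ = e.app b.right ≫ _
    rw [h1, ← h2, Category.assoc]
  refine exists_injective_of_forms hc (ModuleCat.of k (Module.Dual k (L.obj x)))
    (fun a => Module.Dual.eval k (L.obj x) ((j a).hom (1 : k)))
    (fun f => by rw [hj f]) fun v w h => ?_
  have : ModuleCat.ofHom v = ModuleCat.ofHom w := (he x).hom_ext fun b => by
    have hb : j (StructuredArrow.mk (Groupoid.inv b.hom)) = e.app b.left ≫ L.map b.hom := by
      simp [j]
    change (e.app b.left ≫ L.map b.hom) ≫ ModuleCat.ofHom v =
      (e.app b.left ≫ L.map b.hom) ≫ ModuleCat.ofHom w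
    rw [← hb]
    refine ModuleCat.hom_ext (LinearMap.ext_ring ?_)
    exact h (StructuredArrow.mk (Groupoid.inv b.hom))
  exact congrArg ModuleCat.Hom.hom this

theorem exists_injective_components {R : G ⥤ ModuleCat.{0} k}
    {c : φ ⋙ R ⟶ (Functor.const H).obj (ModuleCat.of k k)}
    (hc : (Functor.RightExtension.mk R c).IsPointwiseRightKanExtension) (x : G) :
    ∃ f : (ConnectedComponents (StructuredArrow x φ) → k) →ₗ[k] R.obj x, Function.Injective f := by
  refine exists_injective_of_forms hc
    (ModuleCat.of k (ConnectedComponents (StructuredArrow x φ) → k))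
    (fun a => LinearMap.proj (CategoryTheory.ConnectedComponents.mk a)) (fun f => ?_)
    fun v w h => ?_
  · rw [show CategoryTheory.ConnectedComponents.mk _ = CategoryTheory.ConnectedComponents.mk _ from
      Quotient.sound (Zigzag.of_hom f)]
  · funext o
    induction o using Quotient.inductionOn' with
    | h a => exact h a

/-- If the left and right Kan extensions of the constant representation `k` agree at `x`, then
`StructuredArrow x φ` has finitely many components. -/
theorem finite_components_of_iso {L R : G ⥤ ModuleCat.{0} k}
    {e : (Functor.const H).obj (ModuleCat.of k k) ⟶ φ ⋙ L}
    {c : φ ⋙ R ⟶ (Functor.const H).obj (ModuleCat.of k k)}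
    (he : (Functor.LeftExtension.mk L e).IsPointwiseLeftKanExtension)
    (hc : (Functor.RightExtension.mk R c).IsPointwiseRightKanExtension)
    (x : G) (i : L.obj x ≅ R.obj x) : Finite (ConnectedComponents (StructuredArrow x φ)) := by
  have e' : L.obj x ≃ₗ[k] R.obj x := i.toLinearEquiv
  obtain ⟨f, hf⟩ := exists_injective_dual he hc x
  obtain ⟨g, hg⟩ := exists_injective_components hc x
  have : Module.Finite k (L.obj x) := by
    rw [← Module.rank_lt_aleph0_iff]
    by_contra! hV
    have h1 := lift_rank_lt_rank_dual hV
    have h2 := LinearMap.rank_le_of_injective f hf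
    rw [← e'.rank_eq, ← Cardinal.lift_id (Module.rank k (L.obj x))] at h2
    exact absurd h1 h2.not_gt
  have : Module.Finite k (R.obj x) := Module.Finite.equiv e'
  have : Module.Finite k (ConnectedComponents (StructuredArrow x φ) →₀ k) :=
    Module.Finite.of_injective (g ∘ₗ Finsupp.lcoeFun)
      (hg.comp DFunLike.coe_injective)
  exact Module.Finite.finite_basis
    (Finsupp.basisSingleOne (R := k) (ι := ConnectedComponents (StructuredArrow x φ)))

end Dimension

theorem stmt5 (k : Type) [Field k] {H G : Type} [Groupoid H] [Groupoid G]
    (φ : H ⥤ G) [φ.Faithful] (hφ : Function.Injective φ.obj) :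
    Nonempty ((φ.lan : (H ⥤ ModuleCat k) ⥤ (G ⥤ ModuleCat k)) ≅ φ.ran) ↔
      ∀ x : G, Finite (ConnectedComponents (StructuredArrow x φ)) := by
  constructor
  · rintro ⟨i⟩ x
    exact finite_components_of_iso (φ.isPointwiseLeftKanExtensionLeftKanExtensionUnit _)
      (φ.isPointwiseRightKanExtensionRanCounit _) x ((i.app _).app x)
  · exact fun h => ⟨lanIsoRan (ModuleCat k) φ h⟩
end

section
/- Let k be a field and let H and G be finite groupoids, i.e., groupoids with finitely many connected components (Finite (ConnectedComponents H) and Finite (ConnectedComponents G)) and with all isotropy groups finite (for every object x, the type x ⟶ x is finite). If φ : H ⥤ G is a faithful functor whose object map is injective, then φ is a Frobenius morphism: the left and right Kan extension functors φ.lan, φ.ran : (H ⥤ ModuleCat k) ⥤ (G ⥤ ModuleCat k) are naturally isomorphic. -/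
open CategoryTheory

set_option maxHeartbeats 1000000
set_option synthInstance.maxHeartbeats 200000

namespace FrobeniusKan

open Limits Functor

lemma groupoid_nonempty_hom_of_zigzag {C : Type*} [Groupoid C] {a b : C} (h : Zigzag a b) :
    Nonempty (a ⟶ b) := by
  induction h with
  | refl => exact ⟨𝟙 a⟩
  | tail _ h ih =>
    obtain ⟨f⟩ := ih
    rcases h with ⟨⟨g⟩⟩ | ⟨⟨g⟩⟩
    exacts [⟨f ≫ g⟩, ⟨f ≫ Groupoid.inv g⟩]

lemma finite_groupoid_hom {C : Type*} [Groupoid C] [∀ x : C, Finite (x ⟶ x)] (x y : C) :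
    Finite (x ⟶ y) := by
  cases isEmpty_or_nonempty (x ⟶ y) with
  | inl _ => infer_instance
  | inr h =>
    obtain ⟨g⟩ := h
    exact Finite.of_injective (fun f : x ⟶ y => f ≫ Groupoid.inv g)
      fun f f' h => (cancel_mono (Groupoid.inv g)).1 h

section

variable {C D A : Type*} [Groupoid C] [Groupoid D] [Category* A] (φ : C ⥤ D)

/-- The isomorphism classes of the comma category `φ / x`. -/
abbrev CommaClasses (x : D) : Type _ := Quotient (isIsomorphicSetoid (CostructuredArrow φ x))

lemma finite_commaClasses [Finite (ConnectedComponents C)] [∀ x : D, Finite (x ⟶ x)] (x : D) :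
    Finite (CommaClasses φ x) := by
  have (a b : D) : Finite (a ⟶ b) := finite_groupoid_hom a b
  let s : (Σ c : ConnectedComponents C, φ.obj (Quotient.out c) ⟶ x) → CommaClasses φ x :=
    fun p => Quotient.mk _ (CostructuredArrow.mk p.2)
  refine Finite.of_surjective s fun q => ?_
  induction q using Quotient.inductionOn with | h f => ?_
  obtain ⟨u⟩ := groupoid_nonempty_hom_of_zigzag
    (Quotient.mk_out (s := Zigzag.setoid C) f.left)
  exact ⟨⟨CategoryTheory.ConnectedComponents.mk f.left, φ.map u ≫ f.hom⟩, Quotient.sound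
    ⟨CostructuredArrow.isoMk (Groupoid.isoEquivHom _ _ |>.symm u) rfl⟩⟩

lemma isIsomorphic_of_map_eq {φ : C ⥤ D} {x : D} {f f' : CostructuredArrow φ x}
    (u : f.left ⟶ f'.left)
    (hu : φ.map u = f.hom ≫ inv f'.hom) : IsIsomorphic f f' :=
  ⟨CostructuredArrow.isoMk (Groupoid.isoEquivHom _ _ |>.symm u)
    (by simp [Groupoid.isoEquivHom, hu])⟩

lemma leftKan_hom_ext {φ : C ⥤ D} {F : C ⥤ A} {E : D ⥤ A} {α : F ⟶ φ ⋙ E}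
    (hE : (LeftExtension.mk E α).IsPointwiseLeftKanExtension)
    {x : D} {T : A} {p q : E.obj x ⟶ T}
    (h : ∀ (a : C) (f : φ.obj a ⟶ x), α.app a ≫ E.map f ≫ p = α.app a ≫ E.map f ≫ q) :
    p = q :=
  (hE x).hom_ext fun f =>
    (Category.assoc _ _ _).trans ((h f.left f.hom).trans (Category.assoc _ _ _).symm)

variable [Preadditive A]

open Classical in
/-- The map `F.obj a ⟶ F.obj b` equal to `F.map u` at `g = φ.map u`, and zero at those `g`
which are not in the image of `φ`. -/
noncomputable def extendByZero (F : C ⥤ A) {a b : C} (g : φ.obj a ⟶ φ.obj b) :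
    F.obj a ⟶ F.obj b :=
  if h : ∃ u, φ.map u = g then F.map h.choose else 0

lemma extendByZero_eq_zero (F : C ⥤ A) {a b : C} (g : φ.obj a ⟶ φ.obj b)
    (h : ¬ ∃ u, φ.map u = g) : extendByZero φ F g = 0 :=
  dif_neg h

lemma extendByZero_naturality {F F' : C ⥤ A} (τ : F ⟶ F') {a b : C} (g : φ.obj a ⟶ φ.obj b) :
    extendByZero φ F g ≫ τ.app b = τ.app a ≫ extendByZero φ F' g := by
  unfold extendByZero
  split_ifs <;> simp

variable [φ.Faithful]

@[simp]
lemma extendByZero_map (F : C ⥤ A) {a b : C} (u : a ⟶ b) :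
    extendByZero φ F (φ.map u) = F.map u := by
  have h : ∃ v, φ.map v = φ.map u := ⟨u, rfl⟩
  rw [extendByZero, dif_pos h, φ.map_injective h.choose_spec]

lemma extendByZero_map_comp (F : C ⥤ A) {a b c : C} (u : a ⟶ b) (g : φ.obj b ⟶ φ.obj c) :
    extendByZero φ F (φ.map u ≫ g) = F.map u ≫ extendByZero φ F g := by
  by_cases h : ∃ v, φ.map v = g
  · obtain ⟨v, rfl⟩ := h
    simp [← Functor.map_comp]
  · rw [extendByZero_eq_zero φ F g h, extendByZero_eq_zero, comp_zero]
    rintro ⟨v, hv⟩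
    exact h ⟨inv u ≫ v, by simp [hv]⟩

lemma extendByZero_comp_map (F : C ⥤ A) {a b c : C} (g : φ.obj a ⟶ φ.obj b) (u : b ⟶ c) :
    extendByZero φ F (g ≫ φ.map u) = extendByZero φ F g ≫ F.map u := by
  by_cases h : ∃ v, φ.map v = g
  · obtain ⟨v, rfl⟩ := h
    simp [← Functor.map_comp]
  · rw [extendByZero_eq_zero φ F g h, extendByZero_eq_zero, zero_comp]
    rintro ⟨v, hv⟩
    exact h ⟨v ≫ inv u, by simp [hv]⟩

/-- The cocone on `F`, restricted to the comma category `φ / φ.obj b`, with point `F.obj b`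
whose legs are given by extension by zero. -/
@[simps]
noncomputable def extendByZeroCocone (F : C ⥤ A) (b : C) :
    Cocone (CostructuredArrow.proj φ (φ.obj b) ⋙ F) where
  pt := F.obj b
  ι :=
    { app f := extendByZero φ F f.hom
      naturality f f' u := by
        have h := extendByZero_map_comp φ F u.left f'.hom
        rw [CostructuredArrow.w] at h
        exact h.symm.trans (Category.comp_id _).symm }

variable {φ} {F : C ⥤ A} {E : D ⥤ A} {α : F ⟶ φ ⋙ E}

/-- The component at `b` of the counit exhibiting a left Kan extension as a right one. -/
noncomputable def counitApp (hE : (LeftExtension.mk E α).IsPointwiseLeftKanExtension) (b : C) :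
    E.obj (φ.obj b) ⟶ F.obj b :=
  (hE (φ.obj b)).desc (extendByZeroCocone φ F b)

lemma unit_map_counitApp (hE : (LeftExtension.mk E α).IsPointwiseLeftKanExtension) {a b : C}
    (g : φ.obj a ⟶ φ.obj b) :
    α.app a ≫ E.map g ≫ counitApp hE b = extendByZero φ F g :=
  (Category.assoc _ _ _).symm.trans
    ((hE (φ.obj b)).fac (extendByZeroCocone φ F b) (CostructuredArrow.mk g))

lemma unit_map_counitApp_assoc (hE : (LeftExtension.mk E α).IsPointwiseLeftKanExtension)
    {a b : C} (g : φ.obj a ⟶ φ.obj b) {T : A} (t : F.obj b ⟶ T) :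
    α.app a ≫ E.map g ≫ counitApp hE b ≫ t = extendByZero φ F g ≫ t := by
  simp [← unit_map_counitApp hE]

/-- The counit exhibiting a left Kan extension as a right one. -/
@[simps]
noncomputable def counit (hE : (LeftExtension.mk E α).IsPointwiseLeftKanExtension) :
    φ ⋙ E ⟶ F where
  app b := counitApp hE b
  naturality b b' u := leftKan_hom_ext hE fun a f => by
    have h := unit_map_counitApp hE (f ≫ φ.map u)
    rw [extendByZero_comp_map, ← unit_map_counitApp hE] at h
    simpa using h

lemma sum_counit_unit (hE : (LeftExtension.mk E α).IsPointwiseLeftKanExtension) (x : D)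
    [Fintype (CommaClasses φ x)] :
    ∑ c : CommaClasses φ x, E.map (inv c.out.hom) ≫ counitApp hE c.out.left ≫
      α.app c.out.left ≫ E.map c.out.hom = 𝟙 (E.obj x) := by
  refine leftKan_hom_ext hE fun a f => ?_
  let f₀ : CostructuredArrow φ x := CostructuredArrow.mk f
  simp only [Preadditive.comp_sum]
  rw [Finset.sum_eq_single (Quotient.mk _ f₀)]
  · obtain ⟨e⟩ := Quotient.mk_out (s := isIsomorphicSetoid (CostructuredArrow φ x)) f₀
    set r := Quotient.out (Quotient.mk (isIsomorphicSetoid (CostructuredArrow φ x)) f₀)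
    have hr : φ.map e.inv.left ≫ r.hom = f := CostructuredArrow.w e.inv
    have h : f ≫ inv r.hom = φ.map e.inv.left := by simp [← hr]
    have := unit_map_counitApp_assoc hE (f ≫ inv r.hom) (α.app r.left ≫ E.map r.hom)
    rw [h, extendByZero_map, ← h] at this
    simp only [Functor.map_comp, Category.assoc] at this
    rw [this, ← Category.assoc, α.naturality]
    simp [← Functor.map_comp, hr]
  · intro c _ hc
    have := unit_map_counitApp_assoc hE (f ≫ inv c.out.hom) (α.app c.out.left ≫ E.map c.out.hom)
    rw [extendByZero_eq_zero] at this
    · simpa using this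
    · rintro ⟨u, hu⟩
      exact hc ((Quotient.out_eq c).symm.trans
        (Quotient.sound (isIsomorphic_of_map_eq (f := f₀) u hu)).symm)
  · simp

/-- The morphism to `E.obj x` induced by a family of morphisms `p` indexed by `x / φ`. -/
noncomputable def liftOfLegs (α : F ⟶ φ ⋙ E) {x : D} [Fintype (CommaClasses φ x)] {T : A}
    (p : ∀ a : C, (x ⟶ φ.obj a) → (T ⟶ F.obj a)) : T ⟶ E.obj x :=
  ∑ c : CommaClasses φ x, p c.out.left (inv c.out.hom) ≫ α.app c.out.left ≫ E.map c.out.hom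

lemma liftOfLegs_fac (hE : (LeftExtension.mk E α).IsPointwiseLeftKanExtension) {x : D}
    [Fintype (CommaClasses φ x)] {T : A} (p : ∀ a : C, (x ⟶ φ.obj a) → (T ⟶ F.obj a))
    (hp : ∀ (a b : C) (g : x ⟶ φ.obj a) (u : a ⟶ b), p a g ≫ F.map u = p b (g ≫ φ.map u))
    (b : C) (g : x ⟶ φ.obj b) :
    liftOfLegs α p ≫ E.map g ≫ counitApp hE b = p b g := by
  let f₀ : CostructuredArrow φ x := CostructuredArrow.mk (inv g)
  have key (c : CommaClasses φ x) := unit_map_counitApp hE (c.out.hom ≫ g)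
  simp only [Functor.map_comp, Category.assoc] at key
  simp only [liftOfLegs, Preadditive.sum_comp, Category.assoc, key]
  rw [Finset.sum_eq_single (Quotient.mk _ f₀)]
  · obtain ⟨e⟩ := Quotient.mk_out (s := isIsomorphicSetoid (CostructuredArrow φ x)) f₀
    set r := Quotient.out (Quotient.mk (isIsomorphicSetoid (CostructuredArrow φ x)) f₀)
    have hr : φ.map e.hom.left ≫ inv g = r.hom := CostructuredArrow.w e.hom
    have h : r.hom ≫ g = φ.map e.hom.left := by simp [← hr]
    rw [h, extendByZero_map]
    exact (hp _ _ _ _).trans (congrArg (p b) (by simp [← h]))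
  · intro c _ hc
    rw [extendByZero_eq_zero, comp_zero]
    rintro ⟨u, hu⟩
    exact hc ((Quotient.out_eq c).symm.trans
      (Quotient.sound (isIsomorphic_of_map_eq (f' := f₀) u (by simpa [f₀] using hu))))
  · simp

lemma liftOfLegs_comp_counit (hE : (LeftExtension.mk E α).IsPointwiseLeftKanExtension) {x : D}
    [Fintype (CommaClasses φ x)] {T : A} (m : T ⟶ E.obj x) :
    liftOfLegs α (fun a g => m ≫ E.map g ≫ counitApp hE a) = m := by
  have h := m ≫= sum_counit_unit hE x
  rw [Preadditive.comp_sum, Category.comp_id] at h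
  simpa only [liftOfLegs, Category.assoc] using h

/-- A pointwise left Kan extension along `φ` is also a pointwise right Kan extension, provided
that the comma categories have finitely many isomorphism classes. -/
noncomputable def isPointwiseRightKanExtension [∀ x, Finite (CommaClasses φ x)]
    (hE : (LeftExtension.mk E α).IsPointwiseLeftKanExtension) :
    (RightExtension.mk E (counit hE)).IsPointwiseRightKanExtension := fun x =>
  letI := Fintype.ofFinite (CommaClasses φ x)
  { lift s := liftOfLegs α fun _ g => s.π.app (StructuredArrow.mk g)
    fac s g := liftOfLegs_fac hE (fun _ g => s.π.app (StructuredArrow.mk g))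
      (fun _ _ g u => s.w (StructuredArrow.homMk (f := StructuredArrow.mk g)
        (f' := StructuredArrow.mk (g ≫ φ.map u)) u rfl)) g.right g.hom
    uniq _ m hm := (liftOfLegs_comp_counit hE m).symm.trans
      (congrArg (liftOfLegs α) (funext₂ fun _ g => hm (StructuredArrow.mk g))) }

lemma counit_naturality {F' : C ⥤ A} {E' : D ⥤ A} {α' : F' ⟶ φ ⋙ E'}
    (hE : (LeftExtension.mk E α).IsPointwiseLeftKanExtension)
    (hE' : (LeftExtension.mk E' α').IsPointwiseLeftKanExtension)
    (τ : F ⟶ F') (σ : E ⟶ E') (h : α ≫ whiskerLeft φ σ = τ ≫ α') :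
    whiskerLeft φ σ ≫ counit hE' = counit hE ≫ τ := by
  ext b
  refine leftKan_hom_ext hE fun a f => ?_
  have ha : α.app a ≫ σ.app (φ.obj a) = τ.app a ≫ α'.app a := NatTrans.congr_app h a
  have h' := ha =≫ (E'.map f ≫ counitApp hE' b)
  simp only [Category.assoc, unit_map_counitApp] at h'
  simp [h', unit_map_counitApp_assoc, extendByZero_naturality]

variable (φ A) in
/-- The left and right Kan extension functors along a faithful functor of groupoids agree when
the comma categories have finitely many isomorphism classes. -/
noncomputable def lanIsoRan [∀ x, Finite (CommaClasses φ x)]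
    [∀ F : C ⥤ A, φ.HasPointwiseLeftKanExtension F]
    [∀ F : C ⥤ A, φ.HasRightKanExtension F] :
    (φ.lan : (C ⥤ A) ⥤ (D ⥤ A)) ≅ φ.ran :=
  letI hE (F : C ⥤ A) : (LeftExtension.mk _ (φ.lanUnit.app F)).IsPointwiseLeftKanExtension :=
    isPointwiseLeftKanExtensionOfIsLeftKanExtension _ _
  haveI (F : C ⥤ A) : (φ.lan.obj F).IsRightKanExtension (counit (hE F)) :=
    (isPointwiseRightKanExtension (hE F)).isRightKanExtension
  NatIso.ofComponents
    (fun F => rightKanExtensionUnique _ (counit (hE F)) _ (φ.ranCounit.app F))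
    fun {F F'} τ => (φ.ran.obj F').hom_ext_of_isRightKanExtension (φ.ranCounit.app F') _ _ (by
      have h₁ := counit_naturality (hE F) (hE F') τ (φ.lan.map τ) (φ.lanUnit.naturality τ).symm
      have h₂ := φ.ranCounit.naturality τ
      dsimp at h₂
      simp [h₁, h₂])

end

end FrobeniusKan

theorem stmt7 (k : Type) [Field k] {H G : Type} [Groupoid H] [Groupoid G]
    [Finite (ConnectedComponents H)] [∀ u : H, Finite (u ⟶ u)]
    [Finite (ConnectedComponents G)] [∀ x : G, Finite (x ⟶ x)]
    (φ : H ⥤ G) [φ.Faithful] (hφ : Function.Injective φ.obj) :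
    Nonempty ((φ.lan : (H ⥤ ModuleCat k) ⥤ (G ⥤ ModuleCat k)) ≅ φ.ran) := by
  have := FrobeniusKan.finite_commaClasses φ
  exact ⟨FrobeniusKan.lanIsoRan (ModuleCat k) φ⟩
end

section
/- Let k be a field, H and G groups, and φ : H →* G an injective group homomorphism. Let F : SingleObj H ⥤ SingleObj G be the functor induced by φ between the corresponding one-object groupoids. Then the left and right Kan extension functors F.lan, F.ran : (SingleObj H ⥤ ModuleCat k) ⥤ (SingleObj G ⥤ ModuleCat k) are naturally isomorphic if and only if the subgroup φ.range has finite index in G (φ.range.FiniteIndex). -/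
open CategoryTheory

set_option maxHeartbeats 1000000
set_option synthInstance.maxHeartbeats 200000

/-- A transitive action with a nonzero invariant finitely supported function is on a finite set. -/
theorem Finsupp.finite_of_mapDomain_smul_eq {G X M : Type*} [Group G] [MulAction G X]
    [MulAction.IsPretransitive G X] [AddCommMonoid M] (f : X →₀ M) (hf : f ≠ 0)
    (h : ∀ g : G, f.mapDomain (g • ·) = f) : Finite X := by
  obtain ⟨x, hx⟩ := Finsupp.ne_iff.1 hf
  refine Set.finite_univ_iff.1 (f.hasFiniteSupport.subset fun y _ ↦ ?_)
  obtain ⟨g, rfl⟩ := MulAction.exists_smul_eq G x y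
  rw [Function.mem_support, ← h g, Finsupp.mapDomain_apply (MulAction.injective g)]
  exact hx

namespace Representation

variable (k : Type*) [Field k] {H G : Type*} [Group H] [Group G] (φ : H →* G)

/-- The map from the representation induced from the trivial one to `k[G ⧸ φ.range]`, sending
`⟦g ⊗ₜ a⟧` to `a` at the coset of `g⁻¹`. -/
noncomputable def indTrivialToFinsupp :
    IndV φ (trivial k H k) →ₗ[k] (G ⧸ φ.range →₀ k) :=
  Coinvariants.lift _ (TensorProduct.lift <|
    (Finsupp.linearCombination k fun g : G ↦
      Finsupp.lsingle (R := k) (M := k) (QuotientGroup.mk g⁻¹ : G ⧸ φ.range)) ∘ₗ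
      (MonoidAlgebra.coeffLinearEquiv k).toLinearMap) fun h ↦ by
    ext g : 4
    have : (QuotientGroup.mk (g⁻¹ * (φ h)⁻¹) : G ⧸ φ.range) = QuotientGroup.mk g⁻¹ := by
      simp
    ext
    simp [this]

@[simp]
theorem indTrivialToFinsupp_mk (g : G) (a : k) :
    indTrivialToFinsupp k φ (IndV.mk φ (trivial k H k) g a) =
      Finsupp.single (QuotientGroup.mk g⁻¹ : G ⧸ φ.range) a := by
  simp [indTrivialToFinsupp]

theorem indTrivialToFinsupp_ind (g : G) (x : IndV φ (trivial k H k)) :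
    indTrivialToFinsupp k φ (ind φ (trivial k H k) g x) =
      Finsupp.lmapDomain k k (g • ·) (indTrivialToFinsupp k φ x) := by
  suffices indTrivialToFinsupp k φ ∘ₗ ind φ (trivial k H k) g =
      Finsupp.lmapDomain k k (g • ·) ∘ₗ indTrivialToFinsupp k φ from
    LinearMap.congr_fun this x
  refine IndV.hom_ext _ _ fun g' ↦ LinearMap.ext fun a ↦ ?_
  change indTrivialToFinsupp k φ (ind φ (trivial k H k) g (IndV.mk φ _ g' a)) =
    Finsupp.lmapDomain k k (g • ·) (indTrivialToFinsupp k φ (IndV.mk φ _ g' a))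
  rw [ind_mk, indTrivialToFinsupp_mk, indTrivialToFinsupp_mk, Finsupp.lmapDomain_apply,
    Finsupp.mapDomain_single, mul_inv_rev, inv_inv]
  rfl

theorem IndV.mk_trivial_mul (h : H) (g : G) (a : k) :
    IndV.mk φ (trivial k H k) (φ h * g) a = IndV.mk φ (trivial k H k) g a := by
  refine Coinvariants.mk_eq_iff _ |>.2
    (Coinvariants.mem_ker_of_eq h (.single g 1 ⊗ₜ[k] a) _ ?_)
  simp

theorem indTrivialToFinsupp_injective : Function.Injective (indTrivialToFinsupp k φ) := by
  let p : (G ⧸ φ.range →₀ k) →ₗ[k] IndV φ (trivial k H k) :=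
    Finsupp.lsum k fun q ↦ IndV.mk φ _ q.out⁻¹
  suffices p ∘ₗ indTrivialToFinsupp k φ = LinearMap.id from
    Function.LeftInverse.injective (g := p) (LinearMap.congr_fun this)
  refine IndV.hom_ext _ _ fun g ↦ LinearMap.ext fun a ↦ ?_
  obtain ⟨⟨_, h, rfl⟩, hs⟩ := QuotientGroup.mk_out_eq_mul φ.range g⁻¹
  rw [LinearMap.comp_apply, LinearMap.comp_apply, indTrivialToFinsupp_mk]
  simp only [p, Finsupp.lsum_single, hs, mul_inv_rev, inv_inv, ← map_inv]
  exact IndV.mk_trivial_mul k φ h⁻¹ g a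

end Representation

namespace Rep

/-- Representations of `G` are functors from the one-object groupoid of `G` to modules. -/
noncomputable def equivSingleObjFunctor (k G : Type) [Field k] [Group G] :
    Rep.{0} k G ≌ (SingleObj G ⥤ ModuleCat.{0} k) :=
  (repIsoAction k G).trans (Action.functorCategoryEquivalence _ _)

variable (k : Type) [Field k] {H G : Type} [Group H] [Group G] (φ : H →* G)

/-- Precomposition with `φ.toFunctor` corresponds to restriction of representations along `φ`. -/
noncomputable def equivInverseCompResIso :
    (Functor.whiskeringLeft _ _ _).obj φ.toFunctor ⋙ (equivSingleObjFunctor k H).inverse ≅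
      (equivSingleObjFunctor k G).inverse ⋙ resFunctor φ :=
  Iso.refl _

/-- Left Kan extension along `φ.toFunctor` corresponds to induction along `φ`. -/
noncomputable def equivCompLanIso :
    (equivSingleObjFunctor k H).functor ⋙ φ.toFunctor.lan ≅
      indFunctor k φ ⋙ (equivSingleObjFunctor k G).functor :=
  ((equivSingleObjFunctor k H).toAdjunction.comp
    (φ.toFunctor.lanAdjunction (ModuleCat.{0} k))).leftAdjointUniq
    (((indResAdjunction k φ).comp (equivSingleObjFunctor k G).toAdjunction).ofNatIsoRight
      (equivInverseCompResIso k φ).symm)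

/-- Right Kan extension along `φ.toFunctor` corresponds to coinduction along `φ`. -/
noncomputable def equivCompRanIso :
    (equivSingleObjFunctor k H).functor ⋙ φ.toFunctor.ran ≅
      coindFunctor k φ ⋙ (equivSingleObjFunctor k G).functor :=
  ((φ.toFunctor.ranAdjunction (ModuleCat.{0} k)).comp
    (equivSingleObjFunctor k H).symm.toAdjunction).rightAdjointUniq
    (((equivSingleObjFunctor k G).symm.toAdjunction.comp (resCoindAdjunction k φ)).ofNatIsoLeft
      (equivInverseCompResIso k φ).symm)

theorem nonempty_lan_iso_ran_iff :
    Nonempty ((φ.toFunctor.lan :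
        (SingleObj H ⥤ ModuleCat.{0} k) ⥤ (SingleObj G ⥤ ModuleCat k)) ≅ φ.toFunctor.ran) ↔
      Nonempty (indFunctor.{0} k φ ≅ coindFunctor k φ) := by
  refine ⟨fun ⟨α⟩ ↦ ⟨?_⟩, fun ⟨α⟩ ↦ ⟨?_⟩⟩
  · exact Functor.FullyFaithful.whiskeringRight
      (equivSingleObjFunctor k G).fullyFaithfulFunctor _ |>.preimageIso
      ((equivCompLanIso k φ).symm ≪≫ Functor.isoWhiskerLeft _ α ≪≫ equivCompRanIso k φ)
  · exact ((equivSingleObjFunctor k H).congrLeft.fullyFaithfulInverse).preimageIso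
      ((equivCompLanIso k φ) ≪≫ Functor.isoWhiskerRight α _ ≪≫ (equivCompRanIso k φ).symm)

/-- Restriction along a group isomorphism is an equivalence. -/
noncomputable def resEquivalence (e : H ≃* G) : Rep.{0} k G ≌ Rep.{0} k H where
  functor := resFunctor e.toMonoidHom
  inverse := resFunctor e.symm.toMonoidHom
  unitIso := NatIso.ofComponents (fun A ↦ mkIso (.mk (.refl k A) fun g ↦ by ext; simp))
  counitIso := NatIso.ofComponents (fun A ↦ mkIso (.mk (.refl k A) fun g ↦ by ext; simp))

theorem nonempty_ind_iso_coind_of_finiteIndex (hφ : Function.Injective φ)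
    (h : φ.range.FiniteIndex) : Nonempty (indFunctor.{0} k φ ≅ coindFunctor k φ) := by
  classical
  let E := resEquivalence k (MonoidHom.ofInjective hφ)
  let i : resFunctor φ.range.subtype ⋙ E.functor ≅ resFunctor.{0} (k := k) φ := Iso.refl _
  exact ⟨(indResAdjunction k φ).leftAdjointUniq
      ((E.symm.toAdjunction.comp (indResAdjunction k φ.range.subtype)).ofNatIsoRight i) ≪≫
    Functor.isoWhiskerLeft _ (indCoindNatIso.{0} k φ.range) ≪≫
    (((resCoindAdjunction k φ.range.subtype).comp E.toAdjunction).ofNatIsoLeft i).rightAdjointUniq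
      (resCoindAdjunction k φ)⟩

theorem finiteIndex_of_ind_iso_coind (α : indFunctor.{0} k φ ≅ coindFunctor k φ) :
    φ.range.FiniteIndex := by
  let β := α.app (Rep.trivial k H k)
  let c : coind φ (Rep.trivial k H k) := ⟨fun _ ↦ (1 : k), fun _ _ ↦ by simp⟩
  have hc (g : G) : (coind φ (Rep.trivial k H k)).ρ g c = c := rfl
  let v : Representation.IndV φ (Representation.trivial k H k) := β.inv.hom c
  have hv (g : G) : Representation.ind φ (Representation.trivial k H k) g v = v :=
    (hom_comm_apply β.inv g c).symm.trans (congrArg β.inv.hom (hc g))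
  have hv0 : v ≠ 0 := fun h0 ↦ by
    have h1 : β.hom.hom (β.inv.hom c) = c := ConcreteCategory.congr_hom β.inv_hom_id c
    have h2 : β.inv.hom c = 0 := h0
    rw [h2, map_zero] at h1
    exact zero_ne_one (congrFun (congrArg Subtype.val h1) (1 : G))
  have : Finite (G ⧸ φ.range) := Finsupp.finite_of_mapDomain_smul_eq (G := G)
    (Representation.indTrivialToFinsupp k φ v)
    ((map_ne_zero_iff _ (Representation.indTrivialToFinsupp_injective k φ)).2 hv0) fun g ↦ by
      conv_rhs => rw [← hv g]
      exact (Representation.indTrivialToFinsupp_ind k φ g v).symm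
  exact Subgroup.finiteIndex_of_finite_quotient

end Rep

theorem stmt8 (k : Type) [Field k] {H G : Type} [Group H] [Group G]
    (φ : H →* G) (hφ : Function.Injective φ) :
    Nonempty ((φ.toFunctor.lan :
        (SingleObj H ⥤ ModuleCat k) ⥤ (SingleObj G ⥤ ModuleCat k)) ≅ φ.toFunctor.ran) ↔
      φ.range.FiniteIndex :=
  (Rep.nonempty_lan_iso_ran_iff k φ).trans
    ⟨fun ⟨α⟩ ↦ Rep.finiteIndex_of_ind_iso_coind k φ α,
      Rep.nonempty_ind_iso_coind_of_finiteIndex k φ hφ⟩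
end

section
/- Let k be a field, G a group, and X a G-set (a type with a MulAction of G). Let π : ActionCategory G X ⥤ SingleObj G be the canonical projection from the action groupoid to the one-object groupoid of G. Then for every representation W : ActionCategory G X ⥤ ModuleCat k, the right Kan extension of W along π, evaluated at the unique object of SingleObj G, is k-linearly isomorphic to the product module ∀ x : X, W.obj x (the module of global sections of the underlying vector bundle of W). -/
open CategoryTheory

namespace CategoryTheory.ActionCategory

open Limits

universe u v w

variable {k : Type w} [Ring k] {G : Type v} [Group G] {X : Type u} [MulAction G X]

/-- Transport of a section along two arrows with the same target and the same label agrees. -/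
lemma map_section_eq (W : ActionCategory G X ⥤ ModuleCat.{u} k)
    (s : ∀ x : X, W.obj (objEquiv G X x)) {x y : X} {z : ActionCategory G X}
    (a : objEquiv G X x ⟶ z) (b : objEquiv G X y ⟶ z)
    (h : a.val = b.val) : (W.map a).hom (s x) = (W.map b).hom (s y) := by
  have ha : a.val • x = z.back := a.property
  have hb : b.val • y = z.back := b.property
  obtain rfl : x = y := by
    rw [← h, ← ha] at hb
    exact (MulAction.injective a.val hb).symm
  rw [show a = b from Subtype.ext h]

/-- The arrow with label `g` into the target of the structured arrow `(p, g)`. -/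
def structuredArrowHom (f : StructuredArrow (SingleObj.star G) (π G X)) :
    objEquiv G X ((f.hom : G)⁻¹ • f.right.back) ⟶ f.right :=
  ⟨(f.hom : G), smul_inv_smul (f.hom : G) f.right.back⟩

/-- The object `x`, seen as a structured arrow labelled by the identity. -/
def structuredArrowOfPoint (x : X) : StructuredArrow (SingleObj.star G) (π G X) :=
  StructuredArrow.mk (Y := objEquiv G X x) (𝟙 (SingleObj.star G))

/-- The morphism of structured arrows from `(g⁻¹ • p, 1)` to `(p, g)`. -/
def structuredArrowOfPointHom (f : StructuredArrow (SingleObj.star G) (π G X)) :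
    structuredArrowOfPoint ((f.hom : G)⁻¹ • f.right.back : X) ⟶ f :=
  StructuredArrow.homMk (structuredArrowHom f) (mul_one (f.hom : G))

/-- The module of global sections of `W`, as a cone over the diagram that computes the right
Kan extension of `W` along the projection. -/
def sectionsCone (W : ActionCategory G X ⥤ ModuleCat.{u} k) :
    Cone (StructuredArrow.proj (SingleObj.star G) (π G X) ⋙ W) where
  pt := ModuleCat.of k (∀ x : X, W.obj (objEquiv G X x))
  π :=
    { app f := ModuleCat.ofHom
        ((W.map (structuredArrowHom f)).hom ∘ₗ LinearMap.proj ((f.hom : G)⁻¹ • f.right.back))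
      naturality f g a := by
        ext s
        have h := map_section_eq W s (structuredArrowHom g) (structuredArrowHom f ≫ a.right)
          (StructuredArrow.w a).symm
        rw [W.map_comp] at h
        exact h }

/-- The cone of global sections is a limit cone. -/
def sectionsConeIsLimit (W : ActionCategory G X ⥤ ModuleCat.{u} k) :
    IsLimit (sectionsCone W) where
  lift c := ModuleCat.ofHom (Y := ∀ x : X, W.obj (objEquiv G X x))
    (LinearMap.pi fun x => (c.π.app (structuredArrowOfPoint x)).hom)
  fac c f := by
    ext t
    exact congrArg (fun φ => φ.hom t) (c.w (structuredArrowOfPointHom f))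
  uniq c m hm := by
    ext t
    funext x
    have h := congrArg (fun φ => φ.hom t) (hm (structuredArrowOfPoint x))
    refine Eq.trans ?_ h
    have e := map_section_eq W (m.hom t) (𝟙 (objEquiv G X x))
      (structuredArrowHom (structuredArrowOfPoint x)) rfl
    rw [W.map_id] at e
    exact e

end CategoryTheory.ActionCategory

theorem stmt14 (k : Type) [Field k] (G : Type) [Group G] (X : Type) [MulAction G X]
    (W : ActionCategory G X ⥤ ModuleCat k) :
    Nonempty (((((ActionCategory.π G X).ran).obj W).obj (SingleObj.star G) : ModuleCat k) ≃ₗ[k]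
      (∀ x : X, W.obj (x : ActionCategory G X))) := by
  exact ⟨((ActionCategory.π G X).ranObjObjIsoLimit W (SingleObj.star G) ≪≫
    Limits.limit.isoLimitCone
      ⟨_, ActionCategory.sectionsConeIsLimit W⟩).toLinearEquiv⟩
end
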